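/- Let ν be a finite positive Borel measure on [0,1] with ν({1}) = 0, and suppose 0 < s₀ < 1, where s₀ = sup{ s ∈ [0,1) : ∫₀¹ (1−r)^{−s} dν(r) < ∞ }. Then for any 0 < ε < 1 − s₀ there exists a strictly increasing sequence of nonnegative integers (n_k)_{k≥1} such that m_{n_k} ≥ (n_k + 1)^{−s₀−ε} for every k, and for every s > s₀ the series ∑_{k=1}^∞ m_{n_k} (n_k + 1)^{s−1} diverges. -/

import Mathlib

open MeasureTheory Set ENNReal

noncomputable section

/-- The coefficient multiplier sequence of the Shimorin-type operator:
`m_n = (1/(n+1)) ∫₀¹ (1 - r^{n+1})/(1 - r) dν(r)`. -/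
def mseq (ν : Measure ℝ) (n : ℕ) : ℝ :=
  (1 / (n + 1)) * ∫ r in Icc (0:ℝ) 1, (1 - r ^ (n + 1)) / (1 - r) ∂ν

/-- `s₀ = sup{ s ∈ [0,1) : ∫₀¹ (1-r)^{-s} dν(r) < ∞ }`. -/
def sZero (ν : Measure ℝ) : ℝ :=
  sSup {s : ℝ | s ∈ Ico (0:ℝ) 1 ∧
    ∫⁻ r in Icc (0:ℝ) 1, (ENNReal.ofReal (1 - r)) ^ (-s) ∂ν < ⊤}

theorem mseq_kernel_nonneg {r : ℝ} (hr : r ∈ Icc (0:ℝ) 1) (n : ℕ) :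
    0 ≤ (1 - r ^ (n + 1)) / (1 - r) :=
  div_nonneg (sub_nonneg.2 (pow_le_one₀ hr.1 hr.2)) (sub_nonneg.2 hr.2)

theorem mseq_kernel_le {r : ℝ} (hr : r ∈ Icc (0:ℝ) 1) (n : ℕ) :
    (1 - r ^ (n + 1)) / (1 - r) ≤ n + 1 := by
  rcases hr.2.eq_or_lt with rfl | h
  · simp; positivity
  · rw [div_le_iff₀ (by linarith)]
    have := one_add_mul_le_pow (a := r - 1) (by linarith [hr.1]) (n + 1)
    push_cast at this
    rw [add_sub_cancel] at this
    linarith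

theorem measurable_mseq_kernel (n : ℕ) :
    Measurable fun r : ℝ => (1 - r ^ (n + 1)) / (1 - r) := by
  fun_prop

theorem integrableOn_mseq_kernel (ν : Measure ℝ) [IsFiniteMeasure ν] (n : ℕ) :
    IntegrableOn (fun r : ℝ => (1 - r ^ (n + 1)) / (1 - r)) (Icc 0 1) ν := by
  refine Integrable.of_bound (measurable_mseq_kernel n).aestronglyMeasurable ((n : ℝ) + 1) ?_
  filter_upwards [ae_restrict_mem measurableSet_Icc] with r hr
  rw [Real.norm_of_nonneg (mseq_kernel_nonneg hr n)]
  exact mseq_kernel_le hr n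

theorem mseq_nonneg (ν : Measure ℝ) (n : ℕ) : 0 ≤ mseq ν n :=
  mul_nonneg (by positivity)
    (setIntegral_nonneg measurableSet_Icc fun _ hr => mseq_kernel_nonneg hr n)

theorem half_le_one_sub_pow {r : ℝ} (hr : r ∈ Ico (0:ℝ) 1) {m : ℕ} (hm : 1 ≤ m * (1 - r)) :
    1 / 2 ≤ 1 - r ^ m := by
  have hb : 1 + m * (1 - r) ≤ (1 + (1 - r)) ^ m :=
    one_add_mul_le_pow (by linarith [hr.2]) m
  have hp : r ^ m * (1 + (1 - r)) ^ m ≤ 1 := by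
    rw [← mul_pow]
    exact pow_le_one₀ (mul_nonneg hr.1 (by linarith [hr.2])) (by nlinarith [sq_nonneg (1 - r)])
  nlinarith [pow_nonneg hr.1 m]

/-- The kernel of the multiplier series dominates `(1 - r) ^ (-s)`, already on a dyadic block. -/
theorem exists_rpow_neg_le_sum_kernel {s : ℝ} (hs1 : s < 1) {r : ℝ} (hr : r ∈ Ico (0:ℝ) 1) :
    ∃ F : Finset ℕ, (1 - r) ^ (-s) ≤ 2 * (2 ^ (2 - s) * 2 ^ (1 - s)) *
      ∑ n ∈ F, ((n : ℝ) + 1) ^ (s - 2) * ((1 - r ^ (n + 1)) / (1 - r)) := by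
  have hx : 0 < 1 - r := by linarith [hr.2]
  set x := 1 - r
  have hx1 : x ≤ 1 := by linarith [hr.1]
  set N := ⌈1 / x⌉₊
  have hN1 : 1 / x ≤ N := Nat.le_ceil _
  have hNpos : (0:ℝ) < N := lt_of_lt_of_le (by positivity) hN1
  have hN2 : (N : ℝ) ≤ 2 / x := by
    have h := (Nat.ceil_lt_add_one (show 0 ≤ 1 / x by positivity)).le
    have h' : 1 ≤ 1 / x := by rw [le_div_iff₀ hx]; linarith
    calc (N : ℝ) ≤ 1 / x + 1 := h
      _ ≤ 1 / x + 1 / x := by linarith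
      _ = 2 / x := by ring
  refine ⟨Finset.Ico N (2 * N), ?_⟩
  have hterm : ∀ n ∈ Finset.Ico N (2 * N),
      (2 * (N : ℝ)) ^ (s - 2) * ((1 / 2) / x) ≤
        ((n : ℝ) + 1) ^ (s - 2) * ((1 - r ^ (n + 1)) / x) := by
    intro n hn
    rw [Finset.mem_Ico] at hn
    have hn1 : (N : ℝ) ≤ n := by exact_mod_cast hn.1
    have hn2 : (n : ℝ) + 1 ≤ 2 * N := by exact_mod_cast hn.2
    have hhalf : 1 / 2 ≤ 1 - r ^ (n + 1) := by
      apply half_le_one_sub_pow hr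
      rw [div_le_iff₀ hx] at hN1
      push_cast
      nlinarith
    have hpow : (2 * (N : ℝ)) ^ (s - 2) ≤ ((n : ℝ) + 1) ^ (s - 2) :=
      Real.rpow_le_rpow_of_nonpos (by positivity) hn2 (by linarith)
    gcongr
  have hsum := Finset.card_nsmul_le_sum _ _ _ hterm
  rw [Nat.card_Ico, nsmul_eq_mul, show 2 * N - N = N by omega] at hsum
  have hNpow : (2 / x) ^ (s - 1) ≤ (N : ℝ) ^ (s - 1) :=
    Real.rpow_le_rpow_of_nonpos hNpos hN2 (by linarith)
  have e1 : (N : ℝ) * ((2 * (N : ℝ)) ^ (s - 2) * ((1 / 2) / x)) =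
      2 ^ (s - 2) * (N : ℝ) ^ (s - 1) * ((1 / 2) / x) := by
    rw [Real.mul_rpow (by norm_num) hNpos.le, show s - 1 = (s - 2) + 1 by ring,
      Real.rpow_add_one hNpos.ne']
    ring
  have e2 : (2 / x) ^ (s - 1) / x = 2 ^ (s - 1) * x ^ (-s) := by
    rw [Real.div_rpow (by norm_num) hx.le, show -s = -(s - 1) - 1 by ring,
      Real.rpow_sub_one hx.ne' (-(s - 1)), Real.rpow_neg hx.le]
    field_simp
  have e3 : (2:ℝ) ^ (2 - s) * 2 ^ (s - 2) = 1 := by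
    rw [← Real.rpow_add (by norm_num)]; simp
  have e4 : (2:ℝ) ^ (1 - s) * 2 ^ (s - 1) = 1 := by
    rw [← Real.rpow_add (by norm_num)]; simp
  calc x ^ (-s) = 2 ^ (2 - s) * 2 ^ (s - 2) * (2 ^ (1 - s) * 2 ^ (s - 1)) * x ^ (-s) := by
        rw [e3, e4]; ring
    _ = 2 * (2 ^ (2 - s) * 2 ^ (1 - s)) * (2 ^ (s - 2) * ((2 / x) ^ (s - 1) / x) * (1 / 2)) := by
        rw [e2]; ring
    _ ≤ 2 * (2 ^ (2 - s) * 2 ^ (1 - s)) * (2 ^ (s - 2) * ((N : ℝ) ^ (s - 1) / x) * (1 / 2)) := by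
        gcongr
    _ = 2 * (2 ^ (2 - s) * 2 ^ (1 - s)) * (2 ^ (s - 2) * (N : ℝ) ^ (s - 1) * ((1 / 2) / x)) := by
        ring
    _ ≤ _ := by
        rw [← e1]
        gcongr

theorem lintegral_mseq_kernel (ν : Measure ℝ) [IsFiniteMeasure ν] (s : ℝ) (n : ℕ) :
    ∫⁻ r in Icc (0:ℝ) 1,
        ENNReal.ofReal (((n : ℝ) + 1) ^ (s - 2) * ((1 - r ^ (n + 1)) / (1 - r))) ∂ν =
      ENNReal.ofReal (mseq ν n * ((n : ℝ) + 1) ^ (s - 1)) := by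
  rw [← ofReal_integral_eq_lintegral_ofReal ((integrableOn_mseq_kernel ν n).const_mul _)]
  · rw [integral_const_mul, mseq, show s - 1 = (s - 2) + 1 by ring,
      Real.rpow_add_one (by positivity)]
    congr 1
    field_simp
  · filter_upwards [ae_restrict_mem measurableSet_Icc] with r hr
    exact mul_nonneg (by positivity) (mseq_kernel_nonneg hr n)

theorem lintegral_rpow_neg_lt_top_of_summable (ν : Measure ℝ) [IsFiniteMeasure ν]
    (h1 : ν {1} = 0) {s : ℝ} (hs1 : s < 1)
    (h : Summable fun n : ℕ => mseq ν n * ((n : ℝ) + 1) ^ (s - 1)) :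
    ∫⁻ r in Icc (0:ℝ) 1, (ENNReal.ofReal (1 - r)) ^ (-s) ∂ν < ⊤ := by
  set C : ℝ := 2 * (2 ^ (2 - s) * 2 ^ (1 - s))
  have hC0 : 0 ≤ C := by positivity
  have hne : ∀ᵐ r ∂ν, r ≠ 1 := by
    simpa [ae_iff] using h1
  calc ∫⁻ r in Icc (0:ℝ) 1, (ENNReal.ofReal (1 - r)) ^ (-s) ∂ν
      ≤ ∫⁻ r in Icc (0:ℝ) 1, ENNReal.ofReal C * ∑' n : ℕ,
          ENNReal.ofReal (((n : ℝ) + 1) ^ (s - 2) * ((1 - r ^ (n + 1)) / (1 - r))) ∂ν := by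
        apply lintegral_mono_ae
        filter_upwards [ae_restrict_mem measurableSet_Icc, ae_restrict_of_ae hne] with r hr hr1
        have hr' : r ∈ Ico (0:ℝ) 1 := ⟨hr.1, lt_of_le_of_ne hr.2 hr1⟩
        obtain ⟨F, hF⟩ := exists_rpow_neg_le_sum_kernel hs1 hr'
        rw [ENNReal.ofReal_rpow_of_pos (by linarith [hr'.2])]
        refine (ENNReal.ofReal_le_ofReal hF).trans ?_
        rw [ENNReal.ofReal_mul hC0, ENNReal.ofReal_sum_of_nonneg fun n _ =>
          mul_nonneg (by positivity) (mseq_kernel_nonneg hr n)]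
        gcongr
        exact ENNReal.sum_le_tsum F
    _ = ENNReal.ofReal C * ∑' n : ℕ,
          ENNReal.ofReal (mseq ν n * ((n : ℝ) + 1) ^ (s - 1)) := by
        rw [lintegral_const_mul' _ _ ENNReal.ofReal_ne_top, lintegral_tsum fun n =>
          ((measurable_mseq_kernel n).const_mul _).ennreal_ofReal.aemeasurable]
        simp_rw [lintegral_mseq_kernel]
    _ < ⊤ := ENNReal.mul_lt_top ENNReal.ofReal_lt_top h.tsum_ofReal_lt_top

theorem not_summable_mseq (ν : Measure ℝ) [IsFiniteMeasure ν] (h1 : ν {1} = 0)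
    (hs0 : 0 < sZero ν) {s : ℝ} (hs : sZero ν < s) (hs1 : s < 1) :
    ¬ Summable fun n : ℕ => mseq ν n * ((n : ℝ) + 1) ^ (s - 1) := fun h =>
  hs.not_ge <| le_csSup ⟨1, fun _ ht => ht.1.2.le⟩
    ⟨⟨(hs0.trans hs).le, hs1⟩, lintegral_rpow_neg_lt_top_of_summable ν h1 hs1 h⟩

theorem not_summable_indicator_mseq (ν : Measure ℝ) [IsFiniteMeasure ν] (h1 : ν {1} = 0)
    (hs0 : 0 < sZero ν) {ε : ℝ} (hε1 : ε < 1 - sZero ν) {s : ℝ} (hs : sZero ν < s)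
    (hsε : s < sZero ν + ε) :
    ¬ Summable ({n : ℕ | ((n : ℝ) + 1) ^ (-(sZero ν) - ε) ≤ mseq ν n}.indicator
      fun n : ℕ => mseq ν n * ((n : ℝ) + 1) ^ (s - 1)) := by
  intro h
  refine not_summable_mseq ν h1 hs0 hs (by linarith) ?_
  set A := {n : ℕ | ((n : ℝ) + 1) ^ (-(sZero ν) - ε) ≤ mseq ν n} with hA
  rw [← indicator_self_add_compl A fun n : ℕ => mseq ν n * ((n : ℝ) + 1) ^ (s - 1)]
  refine h.add ?_
  have hp : Summable fun n : ℕ => ((n : ℝ) + 1) ^ (s - 1 - sZero ν - ε) := by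
    have := (summable_nat_add_iff 1).2
      (Real.summable_nat_rpow.2 (show s - 1 - sZero ν - ε < -1 by linarith))
    simpa using this
  refine hp.of_nonneg_of_le (fun n => ?_) fun n => ?_
  · exact indicator_nonneg (fun n _ => mul_nonneg (mseq_nonneg ν n) (by positivity)) n
  · refine indicator_apply_le' (fun hn => ?_) fun _ => by positivity
    have hn' : mseq ν n ≤ ((n : ℝ) + 1) ^ (-(sZero ν) - ε) := by
      rw [hA, mem_compl_iff, mem_ofPred_eq, not_le] at hn
      exact hn.le
    calc mseq ν n * ((n : ℝ) + 1) ^ (s - 1)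
        ≤ ((n : ℝ) + 1) ^ (-(sZero ν) - ε) * ((n : ℝ) + 1) ^ (s - 1) := by gcongr
      _ = ((n : ℝ) + 1) ^ (s - 1 - sZero ν - ε) := by
        rw [← Real.rpow_add (by positivity)]
        congr 1
        ring

/-- **Corollary (divergent subsequence of the multiplier series).**
If ν({1}) = 0 and 0 < s₀ < 1, then for every 0 < ε < 1 - s₀ there is a strictly
increasing sequence (n_k) with `m_{n_k} ≥ (n_k+1)^{-s₀-ε}` such that for all s > s₀
the series `∑_k m_{n_k} (n_k+1)^{s-1}` diverges. -/
theorem multiplier_divergent_subsequence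
    (ν : Measure ℝ) [IsFiniteMeasure ν] (hsupp : ν (Icc (0:ℝ) 1)ᶜ = 0)
    (h1 : ν {1} = 0) (hs0 : 0 < sZero ν) (hs1 : sZero ν < 1)
    (ε : ℝ) (hε0 : 0 < ε) (hε1 : ε < 1 - sZero ν) :
    ∃ n : ℕ → ℕ, StrictMono n ∧
      (∀ k : ℕ, ((n k : ℝ) + 1) ^ (-(sZero ν) - ε) ≤ mseq ν (n k)) ∧
      ∀ s : ℝ, sZero ν < s →
        ¬ Summable (fun k : ℕ => mseq ν (n k) * ((n k : ℝ) + 1) ^ (s - 1)) := by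
  set A := {n : ℕ | ((n : ℝ) + 1) ^ (-(sZero ν) - ε) ≤ mseq ν n}
  have hdiv : ∀ s, sZero ν < s → s < sZero ν + ε →
      ¬ Summable (A.indicator fun n : ℕ => mseq ν n * ((n : ℝ) + 1) ^ (s - 1)) :=
    fun s hs hsε => not_summable_indicator_mseq ν h1 hs0 hε1 hs hsε
  have hinf : A.Infinite := fun hfin =>
    hdiv (sZero ν + ε / 2) (by linarith) (by linarith)
      (summable_of_hasFiniteSupport (hfin.subset support_indicator_subset))
  obtain ⟨n, hn, hrange⟩ : ∃ n : ℕ → ℕ, StrictMono n ∧ range n = A :=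
    ⟨Nat.nth (· ∈ A), Nat.nth_strictMono hinf, Nat.range_nth_of_infinite hinf⟩
  have hmem : ∀ k, n k ∈ A := fun k => hrange ▸ mem_range_self k
  refine ⟨n, hn, hmem, fun s hs hsum => ?_⟩
  obtain ⟨t, ht, htmin⟩ := exists_between (lt_min hs (lt_add_of_pos_right (sZero ν) hε0))
  refine hdiv t ht (htmin.trans_le (min_le_right _ _)) ?_
  rw [← hn.injective.summable_iff fun m hm => indicator_of_notMem (hrange ▸ hm) _]
  refine hsum.of_nonneg_of_le (fun k => ?_) fun k => ?_
  · exact indicator_nonneg (fun n _ => mul_nonneg (mseq_nonneg ν n) (by positivity)) _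
  · rw [Function.comp_apply, indicator_of_mem (hmem k)]
    have hts : t ≤ s := (htmin.trans_le (min_le_left _ _)).le
    refine mul_le_mul_of_nonneg_left ?_ (mseq_nonneg ν _)
    exact Real.rpow_le_rpow_of_exponent_le (le_add_of_nonneg_left (Nat.cast_nonneg _))
      (sub_le_sub_right hts 1)

end
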